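/- arXiv:1809.00690 — 2 statements merged into one kernel-verified Lean document; each statement's English description precedes it below -/
import Mathlib

section
/- Let E and F be finite index sets, let l, r : E → F, and let Φ : (E → M₂(ℂ)) → ℂ be a function on the space of E-tuples of 2×2 complex matrices that is holomorphic (differentiable over ℂ) on the whole space. For C : F → M₂(ℂ) with every C(σ) invertible, define the transformed tuple C[A] by (C[A])_e = C(l(e))⁻¹ · A_e · C(r(e)). Suppose that Φ(C[A]) = Φ(A) for every tuple A and every C such that each C(σ) is unitary with det C(σ) = 1. Then Φ(C[A]) = Φ(A) for every tuple A and every C such that each C(σ) ∈ SL₂(ℂ), i.e. det C(σ) = 1. -/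
open Matrix

attribute [local instance] Matrix.normedAddCommGroup Matrix.normedSpace

/-- The action of a family `C` of matrices attached to `F` on tuples indexed by `E`. -/
noncomputable def gaugeTransform {E F : Type} (l r : E → F) (C : F → Matrix (Fin 2) (Fin 2) ℂ)
    (A : E → Matrix (Fin 2) (Fin 2) ℂ) : E → Matrix (Fin 2) (Fin 2) ℂ :=
  fun e => (C (l e))⁻¹ * A e * C (r e)

/-- Acting by a pointwise product is acting by the two factors in turn. -/
lemma gaugeTransform_mul {E F : Type} (l r : E → F) (C D : F → Matrix (Fin 2) (Fin 2) ℂ)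
    (A : E → Matrix (Fin 2) (Fin 2) ℂ) :
    gaugeTransform l r (fun σ => C σ * D σ) A
      = gaugeTransform l r D (gaugeTransform l r C A) := by
  funext e
  simp only [gaugeTransform, Matrix.mul_inv_rev, Matrix.mul_assoc]

/-- An entire function of one variable that is constant on the real line is constant. -/
lemma Differentiable.eq_of_forall_ofReal_eq {f : ℂ → ℂ} (hf : Differentiable ℂ f) {c : ℂ}
    (h : ∀ t : ℝ, f t = c) (z : ℂ) : f z = c := by
  have hfreq : ∃ᶠ w in nhdsWithin (0 : ℂ) {0}ᶜ, f w = c := by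
    have htend : Filter.Tendsto (fun t : ℝ => (t : ℂ)) (nhdsWithin (0 : ℝ) {0}ᶜ)
        (nhdsWithin (0 : ℂ) {0}ᶜ) := by
      refine tendsto_nhdsWithin_iff.2 ⟨?_, ?_⟩
      · have := Complex.continuous_ofReal.tendsto 0
        rw [Complex.ofReal_zero] at this
        exact this.mono_left nhdsWithin_le_nhds
      · filter_upwards [self_mem_nhdsWithin] with t ht
        simpa using ht
    exact htend.frequently (Filter.Frequently.of_forall h)
  have hf' : AnalyticOnNhd ℂ f Set.univ := fun w _ => hf.analyticAt w
  exact congrFun (hf'.eq_of_frequently_eq (g := fun _ => c)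
    (fun _ _ => analyticAt_const) hfreq) z

/-- If a holomorphic `Φ` is invariant under the special unitary group, it is invariant under
every entire one-parameter family of matrices that is special unitary at real parameters. -/
lemma invariant_of_entire_family {E F : Type} [Fintype E] {l r : E → F}
    {Φ : (E → Matrix (Fin 2) (Fin 2) ℂ) → ℂ} (hΦ : Differentiable ℂ Φ)
    (hSU : ∀ A C, (∀ σ, C σ * (C σ)ᴴ = 1 ∧ (C σ).det = 1) → Φ (gaugeTransform l r C A) = Φ A)
    {T : ℂ → Matrix (Fin 2) (Fin 2) ℂ} (hT : ∀ i j, Differentiable ℂ fun z => T z i j)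
    (hinv : ∀ z, T (-z) * T z = 1) (hreal : ∀ t : ℝ, T t * (T t)ᴴ = 1 ∧ (T t).det = 1)
    (z : F → ℂ) (A : E → Matrix (Fin 2) (Fin 2) ℂ) :
    Φ (gaugeTransform l r (fun σ => T (z σ)) A) = Φ A := by
  let p : F → ℂ → ℂ := fun σ w => ((z σ).re : ℂ) + w * ((z σ).im : ℂ)
  have hp : ∀ σ, Differentiable ℂ (p σ) := fun σ => by fun_prop
  have hTp : ∀ σ i j, Differentiable ℂ fun w => T (p σ w) i j :=
    fun σ i j => (hT i j).comp (hp σ)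
  have hTn : ∀ σ i j, Differentiable ℂ fun w => T (-(p σ w)) i j :=
    fun σ i j => (hT i j).comp (hp σ).neg
  have hdiff : Differentiable ℂ fun w => gaugeTransform l r (fun σ => T (p σ w)) A := by
    have heq : (fun w => gaugeTransform l r (fun σ => T (p σ w)) A)
        = fun w e => T (-(p (l e) w)) * A e * T (p (r e) w) := by
      funext w e
      simp only [gaugeTransform, Matrix.inv_eq_left_inv (hinv _)]
    rw [heq]
    refine differentiable_pi.2 fun e => differentiable_pi.2 fun i => differentiable_pi.2 fun j => ?_
    simp only [Matrix.mul_apply, Fin.sum_univ_two]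
    exact ((((hTn _ _ _).mul_const _).add ((hTn _ _ _).mul_const _)).mul (hTp _ _ _)).add
      ((((hTn _ _ _).mul_const _).add ((hTn _ _ _).mul_const _)).mul (hTp _ _ _))
  have key := (hΦ.comp hdiff).eq_of_forall_ofReal_eq (c := Φ A) (fun t => by
    refine hSU A _ fun σ => ?_
    have : p σ t = (((z σ).re + t * (z σ).im : ℝ) : ℂ) := by simp [p]
    rw [this]
    exact hreal _) Complex.I
  have hpI : ∀ σ, p σ Complex.I = z σ := fun σ => by
    simp only [p, mul_comm Complex.I, Complex.re_add_im]
  simpa only [Function.comp_apply, hpI] using key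

lemma fin_two_of_congr {R : Type*} {a b c d a' b' c' d' : R} (ha : a = a') (hb : b = b')
    (hc : c = c') (hd : d = d') : !![a, b; c, d] = !![a', b'; c', d'] := by
  rw [ha, hb, hc, hd]

/-- The complexified diagonal torus of `SU(2)`. -/
noncomputable def diagTorus (z : ℂ) : Matrix (Fin 2) (Fin 2) ℂ :=
  !![Complex.exp (z * Complex.I), 0; 0, Complex.exp (-(z * Complex.I))]

/-- The complexified rotation group. -/
noncomputable def rotTorus (z : ℂ) : Matrix (Fin 2) (Fin 2) ℂ :=
  !![Complex.cos z, -Complex.sin z; Complex.sin z, Complex.cos z]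

lemma differentiable_diagTorus (i j : Fin 2) : Differentiable ℂ fun z => diagTorus z i j := by
  fin_cases i <;> fin_cases j <;> (simp [diagTorus]; try fun_prop)

lemma differentiable_rotTorus (i j : Fin 2) : Differentiable ℂ fun z => rotTorus z i j := by
  fin_cases i <;> fin_cases j <;> (simp [rotTorus]; try fun_prop)

lemma diagTorus_neg_mul (z : ℂ) : diagTorus (-z) * diagTorus z = 1 := by
  simp [diagTorus, Matrix.one_fin_two, ← Complex.exp_add]

lemma rotTorus_neg_mul (z : ℂ) : rotTorus (-z) * rotTorus z = 1 := by
  have h := Complex.sin_sq_add_cos_sq z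
  simp only [rotTorus, Matrix.one_fin_two, Matrix.mul_fin_two, Complex.cos_neg, Complex.sin_neg]
  apply fin_two_of_congr <;> first | ring1 | linear_combination h

lemma diagTorus_ofReal (t : ℝ) :
    diagTorus t * (diagTorus t)ᴴ = 1 ∧ (diagTorus t).det = 1 := by
  have h : (diagTorus t)ᴴ = diagTorus (-t) := by
    ext i j
    fin_cases i <;> fin_cases j <;> simp [diagTorus, ← Complex.exp_conj]
  refine ⟨?_, ?_⟩
  · simpa [h] using diagTorus_neg_mul (-t)
  · simp [diagTorus, Matrix.det_fin_two, ← Complex.exp_add]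

lemma rotTorus_ofReal (t : ℝ) :
    rotTorus t * (rotTorus t)ᴴ = 1 ∧ (rotTorus t).det = 1 := by
  have h : (rotTorus t)ᴴ = rotTorus (-t) := by
    ext i j
    fin_cases i <;> fin_cases j <;> simp [rotTorus, ← Complex.cos_conj, ← Complex.sin_conj]
  refine ⟨?_, ?_⟩
  · simpa [h] using rotTorus_neg_mul (-t)
  · simp only [rotTorus, Matrix.det_fin_two_of]
    linear_combination Complex.sin_sq_add_cos_sq (t : ℂ)

lemma exists_exp_mul_I_eq {p : ℂ} (hp : p ≠ 0) : ∃ a : ℂ, Complex.exp (a * Complex.I) = p :=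
  ⟨-(Complex.log p * Complex.I), by
    rw [neg_mul, mul_assoc, Complex.I_mul_I, mul_neg_one, neg_neg, Complex.exp_log hp]⟩

/-- Complex Euler angles for unimodular matrices without zero entries. -/
lemma exists_euler_angles {M : Matrix (Fin 2) (Fin 2) ℂ} (hdet : M.det = 1)
    (hM : ∀ i j, M i j ≠ 0) :
    ∃ a b c : ℂ, M = diagTorus a * (rotTorus b * diagTorus c) := by
  have hα := hM 0 0
  have hβ := hM 0 1
  have hγ := hM 1 0
  have hδ := hM 1 1
  rw [Matrix.det_fin_two] at hdet
  obtain ⟨s, hs⟩ := IsAlgClosed.exists_pow_nat_eq (M 0 0 * M 1 1) two_pos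
  obtain ⟨b, hb⟩ := Complex.cos_surjective s
  have hcos : Complex.cos b ^ 2 = M 0 0 * M 1 1 := by rw [hb, hs]
  have hsin : Complex.sin b ^ 2 = -(M 0 1 * M 1 0) := by
    linear_combination Complex.sin_sq_add_cos_sq b - hcos - hdet
  have hc0 : Complex.cos b ≠ 0 := fun h => mul_ne_zero hα hδ (by rw [← hcos, h]; ring)
  have hs0 : Complex.sin b ≠ 0 := fun h => mul_ne_zero hβ hγ (by
    linear_combination hsin - Complex.sin b * h)
  obtain ⟨p, hp⟩ := IsAlgClosed.exists_pow_nat_eq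
    (-(M 0 0 * M 0 1) / (Complex.cos b * Complex.sin b)) two_pos
  have hp0 : p ≠ 0 := by
    rintro rfl
    have : -(M 0 0 * M 0 1) / (Complex.cos b * Complex.sin b) ≠ 0 :=
      div_ne_zero (neg_ne_zero.2 (mul_ne_zero hα hβ)) (mul_ne_zero hc0 hs0)
    exact this (by rw [← hp]; ring)
  have hp' : p ^ 2 * (Complex.cos b * Complex.sin b) = -(M 0 0 * M 0 1) := by
    rw [hp, div_mul_cancel₀ _ (mul_ne_zero hc0 hs0)]
  obtain ⟨a, ha⟩ := exists_exp_mul_I_eq hp0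
  obtain ⟨c, hc⟩ := exists_exp_mul_I_eq (div_ne_zero hα (mul_ne_zero hp0 hc0))
  refine ⟨a, b, c, ?_⟩
  rw [Matrix.eta_fin_two M]
  simp only [diagTorus, rotTorus, Matrix.mul_fin_two, Complex.exp_neg, ha, hc]
  generalize Complex.cos b = x at *
  generalize Complex.sin b = y at *
  refine fin_two_of_congr ?_ ?_ ?_ ?_
  · field_simp
    ring
  · field_simp
    linear_combination hp'
  · field_simp
    refine mul_right_cancel₀ hs0 ?_
    linear_combination M 1 0 * hp' - M 0 0 * hsin
  · field_simp
    linear_combination -p * hcos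

/-- Every unimodular matrix can be rotated to one without zero entries. -/
lemma exists_rotTorus_mul_ne_zero {M : Matrix (Fin 2) (Fin 2) ℂ} (hdet : M.det = 1) :
    ∃ z : ℂ, ∀ i j, (rotTorus z * M) i j ≠ 0 := by
  have hdet' := hdet
  rw [Matrix.det_fin_two] at hdet'
  obtain ⟨t, ht⟩ := Infinite.exists_notMem_finset
    ((Finset.univ : Finset (Fin 2)).image (fun j => (M 0 j / M 1 j).re) ∪
      (Finset.univ : Finset (Fin 2)).image (fun j => (-(M 1 j / M 0 j)).re))
  simp only [Finset.mem_union, Finset.mem_image, Finset.mem_univ, true_and,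
    not_or, not_exists] at ht
  obtain ⟨h₀, h₁⟩ := ht
  have hcos : Complex.cos (Real.arctan t : ℝ) ≠ 0 := by
    rw [← Complex.ofReal_cos]
    exact_mod_cast (Real.cos_arctan_pos t).ne'
  have hsin : Complex.sin (Real.arctan t : ℝ) = t * Complex.cos (Real.arctan t : ℝ) := by
    rw [← Complex.ofReal_cos, ← Complex.ofReal_sin, ← Complex.ofReal_mul,
      ← Real.tan_mul_cos (Real.cos_arctan_pos t).ne', Real.tan_arctan]
  have hcol : ∀ j, M 0 j ≠ 0 ∨ M 1 j ≠ 0 := by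
    intro j
    by_contra! hj
    obtain ⟨hj₀, hj₁⟩ := hj
    fin_cases j <;> simp_all
  have hfst : ∀ j, M 0 j ≠ t * M 1 j := by
    intro j hj
    have h1 : M 1 j ≠ 0 := by
      intro h1
      rcases hcol j with h | h
      · exact h (by rw [hj, h1, mul_zero])
      · exact h h1
    exact h₀ j (by rw [hj, mul_div_cancel_right₀ _ h1, Complex.ofReal_re])
  have hsnd : ∀ j, M 1 j ≠ -(t * M 0 j) := by
    intro j hj
    have h1 : M 0 j ≠ 0 := by
      intro h1
      rcases hcol j with h | h
      · exact h h1
      · exact h (by rw [hj, h1, mul_zero, neg_zero])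
    exact h₁ j (by rw [hj, neg_div, neg_neg, mul_div_cancel_right₀ _ h1, Complex.ofReal_re])
  refine ⟨(Real.arctan t : ℝ), fun i j => ?_⟩
  rw [Matrix.mul_apply, Fin.sum_univ_two]
  fin_cases i
  · intro h
    simp [-Complex.ofReal_arctan, rotTorus, hsin] at h
    refine hfst j (mul_left_cancel₀ hcos ?_)
    linear_combination h
  · intro h
    simp [-Complex.ofReal_arctan, rotTorus, hsin] at h
    refine hsnd j (mul_left_cancel₀ hcos ?_)
    linear_combination h

lemma det_rotTorus (z : ℂ) : (rotTorus z).det = 1 := by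
  simp only [rotTorus, Matrix.det_fin_two_of]
  linear_combination Complex.sin_sq_add_cos_sq z

lemma exists_torus_decomposition {M : Matrix (Fin 2) (Fin 2) ℂ} (hdet : M.det = 1) :
    ∃ z a b c : ℂ, M = rotTorus z * (diagTorus a * (rotTorus b * diagTorus c)) := by
  obtain ⟨z, hz⟩ := exists_rotTorus_mul_ne_zero hdet
  obtain ⟨a, b, c, h⟩ := exists_euler_angles (by rw [Matrix.det_mul, det_rotTorus, hdet, one_mul]) hz
  refine ⟨-z, a, b, c, ?_⟩
  rw [← h, ← Matrix.mul_assoc, rotTorus_neg_mul, Matrix.one_mul]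

/-- Let `E`, `F` be finite index sets, `l r : E → F`, and let `Φ` be a holomorphic
function on tuples of `2×2` complex matrices indexed by `E`. For `C : F → M₂(ℂ)` define
the transformed tuple `(C[A])_e = C(l e)⁻¹ · A_e · C(r e)`. If `Φ` is invariant under all
such transformations with every `C σ` special unitary, then it is invariant under all such
transformations with every `C σ ∈ SL₂(ℂ)`. -/
theorem stmt13 (E F : Type) [Fintype E] [Fintype F] (l r : E → F)
    (Φ : (E → Matrix (Fin 2) (Fin 2) ℂ) → ℂ) (hΦ : Differentiable ℂ Φ)
    (hSU : ∀ (A : E → Matrix (Fin 2) (Fin 2) ℂ) (C : F → Matrix (Fin 2) (Fin 2) ℂ),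
      (∀ σ, C σ * (C σ)ᴴ = 1 ∧ (C σ).det = 1) →
      Φ (fun e => (C (l e))⁻¹ * A e * C (r e)) = Φ A) :
    ∀ (A : E → Matrix (Fin 2) (Fin 2) ℂ) (C : F → Matrix (Fin 2) (Fin 2) ℂ),
      (∀ σ, (C σ).det = 1) →
      Φ (fun e => (C (l e))⁻¹ * A e * C (r e)) = Φ A := by
  intro A C hC
  choose z a b c h using fun σ => exists_torus_decomposition (hC σ)
  have hD := invariant_of_entire_family hΦ hSU differentiable_diagTorus diagTorus_neg_mul
    diagTorus_ofReal
  have hR := invariant_of_entire_family hΦ hSU differentiable_rotTorus rotTorus_neg_mul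
    rotTorus_ofReal
  have hCeq : C = fun σ => rotTorus (z σ) *
      (diagTorus (a σ) * (rotTorus (b σ) * diagTorus (c σ))) := funext h
  change Φ (gaugeTransform l r C A) = Φ A
  rw [hCeq, gaugeTransform_mul, gaugeTransform_mul, gaugeTransform_mul, hD, hR, hD, hR]
end

section
/- Let Φ : M₂(ℂ) → ℂ be holomorphic (differentiable over ℂ) on the space of 2×2 complex matrices. If Φ(U) = 0 for every unitary matrix U with det U = 1 (i.e. for every U ∈ SU₂(ℂ)), then Φ(A) = 0 for every A ∈ M₂(ℂ) with det A = 1 (i.e. for every A ∈ SL₂(ℂ)). -/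
open Matrix

attribute [local instance] Matrix.normedAddCommGroup Matrix.normedSpace

/-- An entire function of one variable vanishing on the real line vanishes identically. -/
lemma entire_eq_zero_of_real {f : ℂ → ℂ} (hf : Differentiable ℂ f)
    (h : ∀ t : ℝ, f t = 0) (z : ℂ) : f z = 0 := by
  have hf' : AnalyticOnNhd ℂ f Set.univ := fun w _ => hf.analyticAt w
  refine hf'.eqOn_zero_of_preconnected_of_frequently_eq_zero isPreconnected_univ
    (Set.mem_univ 0) ?_ (Set.mem_univ z)
  have ht : Filter.Tendsto (fun t : ℝ => (t : ℂ)) (nhdsWithin 0 {0}ᶜ) (nhdsWithin 0 {0}ᶜ) := by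
    refine tendsto_nhdsWithin_of_tendsto_nhds_of_eventually_within _ ?_ ?_
    · exact (Complex.continuous_ofReal.tendsto' 0 0 (by simp)).mono_left nhdsWithin_le_nhds
    · filter_upwards [self_mem_nhdsWithin] with t ht
      simpa using ht
  exact ht.frequently (Filter.Eventually.of_forall h).frequently

/-- `A` lies in the holomorphic hull of `SU₂(ℂ)`: every entire function vanishing on
`SU₂(ℂ)` vanishes at `A`. -/
def InHolomorphicHullSU (A : Matrix (Fin 2) (Fin 2) ℂ) : Prop :=
  ∀ Φ : Matrix (Fin 2) (Fin 2) ℂ → ℂ, Differentiable ℂ Φ →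
    (∀ U : Matrix (Fin 2) (Fin 2) ℂ, U * Uᴴ = 1 → U.det = 1 → Φ U = 0) → Φ A = 0

lemma differentiable_matrix_of_entries {E : Type*} [NormedAddCommGroup E] [NormedSpace ℂ E]
    {f : E → Matrix (Fin 2) (Fin 2) ℂ} (h : ∀ i j, Differentiable ℂ fun x => f x i j) :
    Differentiable ℂ f :=
  differentiable_pi.2 fun i => differentiable_pi.2 fun j => h i j

lemma differentiable_matrix_entry (i j : Fin 2) :
    Differentiable ℂ fun M : Matrix (Fin 2) (Fin 2) ℂ => M i j :=
  differentiable_pi.1 (differentiable_pi.1 differentiable_id i) j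

lemma InHolomorphicHullSU.mul {A B : Matrix (Fin 2) (Fin 2) ℂ}
    (hA : InHolomorphicHullSU A) (hB : InHolomorphicHullSU B) :
    InHolomorphicHullSU (A * B) := by
  intro Φ hΦ hSU
  refine hA (fun M => Φ (M * B)) (hΦ.comp (differentiable_matrix_of_entries fun i j => ?_)) ?_
  · simp only [Matrix.mul_apply]
    exact Differentiable.fun_sum fun k _ => (differentiable_matrix_entry i k).mul_const _
  intro U hU hdet
  refine hB (fun M => Φ (U * M)) (hΦ.comp (differentiable_matrix_of_entries fun i j => ?_)) ?_
  · simp only [Matrix.mul_apply]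
    exact Differentiable.fun_sum fun k _ => (differentiable_matrix_entry k j).const_mul _
  intro V hV hdetV
  refine hSU _ ?_ (by rw [det_mul, hdet, hdetV, one_mul])
  rw [conjTranspose_mul, Matrix.mul_assoc, ← Matrix.mul_assoc V, hV, Matrix.one_mul, hU]

lemma inHolomorphicHullSU_of_curve {γ : ℂ → Matrix (Fin 2) (Fin 2) ℂ}
    (hγ : ∀ i j, Differentiable ℂ fun z => γ z i j)
    (hU : ∀ t : ℝ, γ t * (γ t)ᴴ = 1) (hdet : ∀ t : ℝ, (γ t).det = 1) (z : ℂ) :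
    InHolomorphicHullSU (γ z) := fun _ hΦ hSU =>
  entire_eq_zero_of_real (hΦ.comp (differentiable_matrix_of_entries hγ))
    (fun t => hSU _ (hU t) (hdet t)) z

lemma inHolomorphicHullSU_rotation {x y : ℂ} (h : x ^ 2 + y ^ 2 = 1) :
    InHolomorphicHullSU !![x, -y; y, x] := by
  have key (z : ℂ) : InHolomorphicHullSU
      !![Complex.cos z, -Complex.sin z; Complex.sin z, Complex.cos z] := by
    refine inHolomorphicHullSU_of_curve
      (γ := fun z => !![Complex.cos z, -Complex.sin z; Complex.sin z, Complex.cos z]) ?_ ?_ ?_ z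
    · intro i j
      fin_cases i <;> fin_cases j <;> simp
    · intro t
      have := Complex.sin_sq_add_cos_sq (t : ℂ)
      ext i j
      fin_cases i <;> fin_cases j <;>
        simp [Matrix.mul_apply, Fin.sum_univ_two, ← Complex.cos_conj, ← Complex.sin_conj] <;>
        first | ring1 | linear_combination this
    · intro t
      rw [det_fin_two_of]
      linear_combination Complex.sin_sq_add_cos_sq (t : ℂ)
  obtain ⟨z, rfl⟩ := Complex.cos_surjective x
  have hy : y ^ 2 = Complex.sin z ^ 2 := by
    linear_combination h - Complex.sin_sq_add_cos_sq z
  rcases sq_eq_sq_iff_eq_or_eq_neg.1 hy with rfl | rfl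
  · exact key z
  · simpa using key (-z)

lemma inHolomorphicHullSU_diagonal {w : ℂ} (hw : w ≠ 0) :
    InHolomorphicHullSU !![w, 0; 0, w⁻¹] := by
  have key (z : ℂ) : InHolomorphicHullSU
      !![Complex.exp (Complex.I * z), 0; 0, Complex.exp (-(Complex.I * z))] := by
    refine inHolomorphicHullSU_of_curve
      (γ := fun z => !![Complex.exp (Complex.I * z), 0; 0, Complex.exp (-(Complex.I * z))])
      ?_ ?_ ?_ z
    · intro i j
      fin_cases i <;> fin_cases j <;> simp <;> fun_prop
    · intro t
      ext i j
      fin_cases i <;> fin_cases j <;>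
        simp [Matrix.mul_apply, Fin.sum_univ_two, ← Complex.exp_conj, ← Complex.exp_add]
    · intro t
      simp [det_fin_two_of, ← Complex.exp_add]
  have hz : Complex.I * (-Complex.I * Complex.log w) = Complex.log w := by
    linear_combination -Complex.log w * Complex.I_sq
  simpa only [hz, Complex.exp_neg, Complex.exp_log hw] using key (-Complex.I * Complex.log w)

lemma inHolomorphicHullSU_of_entries_ne_zero {a b c d : ℂ} (hdet : a * d - b * c = 1)
    (ha : a ≠ 0) (hb : b ≠ 0) (hc : c ≠ 0) (hd : d ≠ 0) :
    InHolomorphicHullSU !![a, b; c, d] := by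
  obtain ⟨m, hm⟩ := IsAlgClosed.exists_pow_nat_eq (a / d) (n := 2) two_pos
  obtain ⟨n, hn⟩ := IsAlgClosed.exists_pow_nat_eq (-b / c) (n := 2) two_pos
  obtain ⟨w, hw⟩ := IsAlgClosed.exists_pow_nat_eq (m * n) (n := 2) two_pos
  have hm0 : m ≠ 0 := by
    rintro rfl
    exact div_ne_zero ha hd (by simpa using hm.symm)
  have hn0 : n ≠ 0 := by
    rintro rfl
    exact div_ne_zero (neg_ne_zero.2 hb) hc (by simpa using hn.symm)
  have hw0 : w ≠ 0 := by
    rintro rfl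
    exact mul_ne_zero hm0 hn0 (by simpa using hw.symm)
  have hma : m ^ 2 * d = a := by rw [hm]; field_simp
  have hnb : n ^ 2 * c = -b := by rw [hn]; field_simp
  have h1 : (m * d) ^ 2 + (n * c) ^ 2 = 1 := by
    linear_combination d * hma + c * hnb + hdet
  have h := ((inHolomorphicHullSU_diagonal hw0).mul (inHolomorphicHullSU_rotation h1)).mul
    (inHolomorphicHullSU_diagonal (div_ne_zero hm0 hw0))
  convert h using 1
  ext i j
  fin_cases i <;> fin_cases j <;> simp [Matrix.mul_apply, Fin.sum_univ_two] <;> field_simp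
  · linear_combination -hma
  · linear_combination m * hnb + n * c * hw
  · linear_combination hw

lemma inHolomorphicHullSU_of_det_eq_one {A : Matrix (Fin 2) (Fin 2) ℂ} (hA : A.det = 1) :
    InHolomorphicHullSU A := by
  obtain ⟨a, b, c, d, rfl⟩ : ∃ a b c d, A = !![a, b; c, d] :=
    ⟨_, _, _, _, A.eta_fin_two⟩
  rw [det_fin_two_of] at hA
  have hne {p q : ℂ} (h : p ≠ 0 ∨ q ≠ 0) :
      (Polynomial.C p + Polynomial.C q * Polynomial.X : Polynomial ℂ) ≠ 0 := by
    intro h0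
    have e0 := congrArg (Polynomial.eval 0) h0
    have e1 := congrArg (Polynomial.eval 1) h0
    simp at e0 e1
    simp_all
  have hab : a ≠ 0 ∨ b ≠ 0 := by
    by_contra! h
    simp [h] at hA
  have hcd : c ≠ 0 ∨ d ≠ 0 := by
    by_contra! h
    simp [h] at hA
  have hX : (1 + Polynomial.X ^ 2 : Polynomial ℂ) ≠ 0 := by
    intro h0
    simpa using congrArg (Polynomial.eval 0) h0
  have hba : b ≠ 0 ∨ -a ≠ 0 := by simpa [or_comm] using hab
  have hdc : d ≠ 0 ∨ -c ≠ 0 := by simpa [or_comm] using hcd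
  obtain ⟨s, hs⟩ := Polynomial.exists_eval_ne_zero_of_natDegree_lt_card _
    (mul_ne_zero (mul_ne_zero (mul_ne_zero (mul_ne_zero (hne hab) (hne hba)) (hne hcd))
      (hne hdc)) hX) (by
        rw [Cardinal.mk_complex]
        exact Cardinal.nat_lt_continuum _)
  simp only [Polynomial.eval_mul, Polynomial.eval_add, Polynomial.eval_C, Polynomial.eval_X,
    Polynomial.eval_one, Polynomial.eval_pow, mul_ne_zero_iff] at hs
  obtain ⟨⟨⟨⟨h1, h2⟩, h3⟩, h4⟩, h5⟩ := hs
  obtain ⟨x, hx⟩ := IsAlgClosed.exists_pow_nat_eq (1 + s ^ 2)⁻¹ (n := 2) two_pos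
  have hx0 : x ≠ 0 := by
    rintro rfl
    exact inv_ne_zero h5 (by simpa using hx.symm)
  have hxs : x ^ 2 + (x * s) ^ 2 = 1 := by
    rw [mul_pow, hx]
    field_simp
  have hdet : x * (a + b * s) * (x * (d + -c * s)) - x * (b + -a * s) * (x * (c + d * s)) = 1 := by
    linear_combination (a * d - b * c) * hxs + hA
  have h := (inHolomorphicHullSU_of_entries_ne_zero hdet (mul_ne_zero hx0 h1)
    (mul_ne_zero hx0 h2) (mul_ne_zero hx0 h3) (mul_ne_zero hx0 h4)).mul
    (inHolomorphicHullSU_rotation (x := x) (y := -(x * s)) (by rw [neg_sq, hxs]))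
  convert h using 1
  ext i j
  fin_cases i <;> fin_cases j <;> simp [Matrix.mul_apply, Fin.sum_univ_two]
  · linear_combination -a * hxs
  · linear_combination -b * hxs
  · linear_combination -c * hxs
  · linear_combination -d * hxs

/-- If a holomorphic function on the space of `2×2` complex matrices vanishes on
`SU₂(ℂ)`, then it vanishes on all of `SL₂(ℂ)`. -/
theorem stmt14 (Φ : Matrix (Fin 2) (Fin 2) ℂ → ℂ) (hΦ : Differentiable ℂ Φ)
    (hSU : ∀ U : Matrix (Fin 2) (Fin 2) ℂ, U * Uᴴ = 1 → U.det = 1 → Φ U = 0) :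
    ∀ A : Matrix (Fin 2) (Fin 2) ℂ, A.det = 1 → Φ A = 0 := fun _ hA =>
  inHolomorphicHullSU_of_det_eq_one hA Φ hΦ hSU
end
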